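/- For all Boolean normal monotonic (BNM) schemes 𝕏, 𝕏', 𝕏'', the inclusion SS(𝕏) ∪ TT(𝕏') ⊆ ST(𝕏'') is strict; in particular, for pairwise distinct propositional variables p, q, r, the inference {p ∨ (q ∧ ¬q)} ⇒ p ∧ (r ∨ ¬r) belongs to ST(𝕏'') but neither to SS(𝕏) nor to TT(𝕏'). -/

import Mathlib

namespace ThreeValued

/-- Formulas of the propositional language: countably many variables,
negation, conjunction, disjunction. -/
inductive Fml : Type
  | var : ℕ → Fml
  | neg : Fml → Fml
  | conj : Fml → Fml → Fml
  | disj : Fml → Fml → Fml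
deriving DecidableEq

/-- An inference Γ ⇒ φ: a finite set of premises and a conclusion. -/
structure Infer : Type where
  prem : Finset Fml
  concl : Fml

/-- A set of inferences is closed under transitivity:
whenever there is a nonempty Δ with Δ ⇒ φ ∈ L and Γ ⇒ δ ∈ L for all δ ∈ Δ,
then Γ ⇒ φ ∈ L. -/
def TransClosed (L : Set Infer) : Prop :=
  ∀ (Γ Δ : Finset Fml) (φ : Fml), Δ.Nonempty →
    (⟨Δ, φ⟩ : Infer) ∈ L → (∀ δ ∈ Δ, (⟨Γ, δ⟩ : Infer) ∈ L) → (⟨Γ, φ⟩ : Infer) ∈ L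

/-- The transitive closure of a set of inferences: the least superset closed
under transitivity. -/
def T (L : Set Infer) : Set Infer := ⋂₀ {L' : Set Infer | L ⊆ L' ∧ TransClosed L'}

/-- A set of inferences is open under dual transitivity:
whenever there is a nonempty Δ with Δ ⇒ φ ∉ L and Γ ⇒ δ ∉ L for all δ ∈ Δ,
then Γ ⇒ φ ∉ L. -/
def DualTransClosed (L : Set Infer) : Prop :=
  ∀ (Γ Δ : Finset Fml) (φ : Fml), Δ.Nonempty →
    (⟨Δ, φ⟩ : Infer) ∉ L → (∀ δ ∈ Δ, (⟨Γ, δ⟩ : Infer) ∉ L) → (⟨Γ, φ⟩ : Infer) ∉ L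

/-- The dual transitive closure: the greatest subset open under dual
transitivity. -/
def Td (L : Set Infer) : Set Infer := ⋃₀ {L' : Set Infer | L' ⊆ L ∧ DualTransClosed L'}

/-- The three truth values 0, 1/2, 1. -/
inductive V3 : Type
  | zero | half | one
deriving DecidableEq

/-- A three-valued scheme: a triple of truth functions for ¬, ∧ and ∨. -/
structure Scheme : Type where
  fneg : V3 → V3
  fconj : V3 → V3 → V3
  fdisj : V3 → V3 → V3

/-- Boolean normality: on Boolean inputs the operations agree with the
classical ones. -/
def BooleanNormal (X : Scheme) : Prop :=
  X.fneg .zero = .one ∧ X.fneg .one = .zero ∧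
  X.fconj .one .one = .one ∧ X.fconj .one .zero = .zero ∧
  X.fconj .zero .one = .zero ∧ X.fconj .zero .zero = .zero ∧
  X.fdisj .one .one = .one ∧ X.fdisj .one .zero = .one ∧
  X.fdisj .zero .one = .one ∧ X.fdisj .zero .zero = .zero

/-- The information order: 1/2 is below 0 and below 1. -/
def infLe (a b : V3) : Prop := a = .half ∨ a = b

/-- Monotonicity of a scheme with respect to the information order. -/
def Monotonic (X : Scheme) : Prop :=
  (∀ a b, infLe a b → infLe (X.fneg a) (X.fneg b)) ∧
  (∀ a₁ a₂ b₁ b₂, infLe a₁ b₁ → infLe a₂ b₂ → infLe (X.fconj a₁ a₂) (X.fconj b₁ b₂)) ∧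
  (∀ a₁ a₂ b₁ b₂, infLe a₁ b₁ → infLe a₂ b₂ → infLe (X.fdisj a₁ a₂) (X.fdisj b₁ b₂))

/-- Boolean normal monotonic schemes. -/
def BNM (X : Scheme) : Prop := BooleanNormal X ∧ Monotonic X

/-- Valuations respecting a scheme. -/
def Respects (X : Scheme) (v : Fml → V3) : Prop :=
  (∀ φ, v (.neg φ) = X.fneg (v φ)) ∧
  (∀ φ ψ, v (.conj φ ψ) = X.fconj (v φ) (v ψ)) ∧
  (∀ φ ψ, v (.disj φ ψ) = X.fdisj (v φ) (v ψ))

/-- The strict formula-standard s = {1}. -/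
def sStd : Set V3 := {.one}

/-- The tolerant formula-standard t = {1, 1/2}. -/
def tStd : Set V3 := {.one, .half}

/-- An inference is xy-valid over a scheme X if every valuation respecting X
whose value on each premise is in x gives the conclusion a value in y. -/
def Valid (X : Scheme) (x y : Set V3) (I : Infer) : Prop :=
  ∀ v : Fml → V3, Respects X v → (∀ γ ∈ I.prem, v γ ∈ x) → v I.concl ∈ y

/-- The ss-valid inferences over X. -/
def SS (X : Scheme) : Set Infer := {I | Valid X sStd sStd I}

/-- The tt-valid inferences over X. -/
def TT (X : Scheme) : Set Infer := {I | Valid X tStd tStd I}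

/-- The st-valid inferences over X. -/
def ST (X : Scheme) : Set Infer := {I | Valid X sStd tStd I}

/-- The ts-valid inferences over X. -/
def TS (X : Scheme) : Set Infer := {I | Valid X tStd sStd I}

/-- Classical two-valued valuations. -/
def RespectsCL (v : Fml → Bool) : Prop :=
  (∀ φ, v (.neg φ) = ! v φ) ∧
  (∀ φ ψ, v (.conj φ ψ) = (v φ && v ψ)) ∧
  (∀ φ ψ, v (.disj φ ψ) = (v φ || v ψ))

/-- The classically valid inferences. -/
def CL : Set Infer :=
  {I | ∀ v : Fml → Bool, RespectsCL v → (∀ γ ∈ I.prem, v γ = true) → v I.concl = true}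

/-- Substitution: the homomorphic extension of a map from variables to
formulas. -/
def subst (σ : ℕ → Fml) : Fml → Fml
  | .var n => σ n
  | .neg φ => .neg (subst σ φ)
  | .conj φ ψ => .conj (subst σ φ) (subst σ ψ)
  | .disj φ ψ => .disj (subst σ φ) (subst σ ψ)

/-- Reflexivity. -/
def PropR (L : Set Infer) : Prop := ∀ φ : Fml, (⟨{φ}, φ⟩ : Infer) ∈ L

/-- Monotonicity (weakening). -/
def PropM (L : Set Infer) : Prop :=
  ∀ (Γ Sg : Finset Fml) (φ : Fml), (⟨Γ, φ⟩ : Infer) ∈ L → Γ ⊆ Sg → (⟨Sg, φ⟩ : Infer) ∈ L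

/-- Structurality (closure under substitutions). -/
def PropS (L : Set Infer) : Prop :=
  ∀ (Γ : Finset Fml) (φ : Fml), (⟨Γ, φ⟩ : Infer) ∈ L →
    ∀ σ : ℕ → Fml, (⟨Γ.image (subst σ), subst σ φ⟩ : Infer) ∈ L

/-- The Tarskian closure: the least superset satisfying (R), (M), (T), (S). -/
def Tar (L : Set Infer) : Set Infer :=
  ⋂₀ {L' : Set Infer | L ⊆ L' ∧ PropR L' ∧ PropM L' ∧ TransClosed L' ∧ PropS L'}

/-- L⋆: the inferences whose premise set is an antitheorem of L or whose
conclusion is a theorem of L. -/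
def starL (L : Set Infer) : Set Infer :=
  {I | (∀ ψ : Fml, (⟨I.prem, ψ⟩ : Infer) ∈ L) ∨ (∀ Δ : Finset Fml, (⟨Δ, I.concl⟩ : Infer) ∈ L)}

/-- The propositional variables occurring in a formula. -/
def fvars : Fml → Finset ℕ
  | .var n => {n}
  | .neg φ => fvars φ
  | .conj φ ψ => fvars φ ∪ fvars ψ
  | .disj φ ψ => fvars φ ∪ fvars ψ

/-- The valuation over `X` extending an assignment to the variables. -/
def Scheme.eval (X : Scheme) (a : ℕ → V3) : Fml → V3
  | .var n => a n
  | .neg φ => X.fneg (X.eval a φ)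
  | .conj φ ψ => X.fconj (X.eval a φ) (X.eval a ψ)
  | .disj φ ψ => X.fdisj (X.eval a φ) (X.eval a ψ)

theorem Scheme.respects_eval (X : Scheme) (a : ℕ → V3) : Respects X (X.eval a) :=
  ⟨fun _ => rfl, fun _ _ => rfl, fun _ _ => rfl⟩

/-- The classical valuation extending a Boolean assignment to the variables. -/
def boolEval (a : ℕ → Bool) : Fml → Bool
  | .var n => a n
  | .neg φ => ! boolEval a φ
  | .conj φ ψ => boolEval a φ && boolEval a ψ
  | .disj φ ψ => boolEval a φ || boolEval a ψ

/-- The embedding of the classical truth values into the three values. -/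
def V3.ofBool : Bool → V3
  | true => .one
  | false => .zero

theorem infLe_ofBool_true {x : V3} : infLe x (.ofBool true) ↔ x ∈ tStd := by
  cases x <;> simp [infLe, V3.ofBool, tStd]

theorem eq_half_of_infLe {x : V3} (h₀ : infLe x .zero) (h₁ : infLe x .one) : x = .half := by
  cases x <;> simp_all [infLe]

section Scheme

variable {X : Scheme}

theorem BooleanNormal.fneg_ofBool (hX : BooleanNormal X) (b : Bool) :
    X.fneg (.ofBool b) = .ofBool (! b) := by
  obtain ⟨_, _, _⟩ := hX
  cases b <;> simp_all [V3.ofBool]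

theorem BooleanNormal.fconj_ofBool (hX : BooleanNormal X) (b c : Bool) :
    X.fconj (.ofBool b) (.ofBool c) = .ofBool (b && c) := by
  obtain ⟨_, _, _, _, _, _, _⟩ := hX
  cases b <;> cases c <;> simp_all [V3.ofBool]

theorem BooleanNormal.fdisj_ofBool (hX : BooleanNormal X) (b c : Bool) :
    X.fdisj (.ofBool b) (.ofBool c) = .ofBool (b || c) := by
  obtain ⟨_, _, _, _, _, _, _, _, _, _⟩ := hX
  cases b <;> cases c <;> simp_all [V3.ofBool]

theorem BooleanNormal.respects_boolEval (hX : BooleanNormal X) (a : ℕ → Bool) :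
    Respects X fun φ => .ofBool (boolEval a φ) :=
  ⟨fun _ => (hX.fneg_ofBool _).symm, fun _ _ => (hX.fconj_ofBool _ _).symm,
    fun _ _ => (hX.fdisj_ofBool _ _).symm⟩

/-- A classical valuation refining a three-valued one on the variables refines it everywhere. -/
theorem BNM.infLe_boolEval (hX : BNM X) {v : Fml → V3} (hv : Respects X v) {a : ℕ → Bool}
    (ha : ∀ n, infLe (v (.var n)) (.ofBool (a n))) (φ : Fml) :
    infLe (v φ) (.ofBool (boolEval a φ)) := by
  obtain ⟨hN, hneg, hconj, hdisj⟩ := hX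
  induction φ with
  | var n => exact ha n
  | neg φ ih =>
    rw [hv.1, boolEval, ← hN.fneg_ofBool]
    exact hneg _ _ ih
  | conj φ ψ ih₁ ih₂ =>
    rw [hv.2.1, boolEval, ← hN.fconj_ofBool]
    exact hconj _ _ _ _ ih₁ ih₂
  | disj φ ψ ih₁ ih₂ =>
    rw [hv.2.2, boolEval, ← hN.fdisj_ofBool]
    exact hdisj _ _ _ _ ih₁ ih₂

theorem BNM.exists_infLe_boolEval (hX : BNM X) {v : Fml → V3} (hv : Respects X v) :
    ∃ a : ℕ → Bool, ∀ φ, infLe (v φ) (.ofBool (boolEval a φ)) := by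
  refine ⟨fun n => decide (v (.var n) = .one), hX.infLe_boolEval hv fun n => ?_⟩
  cases h : v (.var n) <;> simp [infLe, V3.ofBool]

theorem BNM.fneg_half (hX : BNM X) : X.fneg .half = .half := by
  obtain ⟨⟨h₀, h₁, _⟩, hneg, _⟩ := hX
  exact eq_half_of_infLe (h₁ ▸ hneg .half .one (.inl rfl)) (h₀ ▸ hneg .half .zero (.inl rfl))

theorem BNM.fconj_half_half (hX : BNM X) : X.fconj .half .half = .half := by
  obtain ⟨⟨_, _, h₁, _, _, h₀, _⟩, _, hconj, _⟩ := hX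
  exact eq_half_of_infLe (h₀ ▸ hconj .half .half .zero .zero (.inl rfl) (.inl rfl))
    (h₁ ▸ hconj .half .half .one .one (.inl rfl) (.inl rfl))

theorem BNM.fdisj_half_half (hX : BNM X) : X.fdisj .half .half = .half := by
  obtain ⟨⟨_, _, _, _, _, _, h₁, _, _, h₀⟩, _, _, hdisj⟩ := hX
  exact eq_half_of_infLe (h₀ ▸ hdisj .half .half .zero .zero (.inl rfl) (.inl rfl))
    (h₁ ▸ hdisj .half .half .one .one (.inl rfl) (.inl rfl))

theorem BNM.fconj_one_half (hX : BNM X) : X.fconj .one .half = .half := by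
  obtain ⟨⟨_, _, h₁, h₀, _⟩, _, hconj, _⟩ := hX
  exact eq_half_of_infLe (by simpa only [h₀] using hconj .one .half .one .zero (.inr rfl) (.inl rfl))
    (by simpa only [h₁] using hconj .one .half .one .one (.inr rfl) (.inl rfl))

theorem BNM.fdisj_zero_half (hX : BNM X) : X.fdisj .zero .half = .half := by
  obtain ⟨⟨_, _, _, _, _, _, _, _, h₁, h₀⟩, _, _, hdisj⟩ := hX
  exact eq_half_of_infLe (by simpa only [h₀] using hdisj .zero .half .zero .zero (.inr rfl) (.inl rfl))
    (by simpa only [h₁] using hdisj .zero .half .zero .one (.inr rfl) (.inl rfl))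

/-- Every inference preserving truth under the classical valuations is st-valid. -/
theorem BNM.mem_ST_of_boolEval (hX : BNM X) {I : Infer}
    (h : ∀ a, (∀ γ ∈ I.prem, boolEval a γ = true) → boolEval a I.concl = true) : I ∈ ST X := by
  intro v hv hprem
  obtain ⟨a, ha⟩ := hX.exists_infLe_boolEval hv
  have hconcl := h a fun γ hγ => by
    have hle := ha γ
    rw [Set.mem_singleton_iff.1 (hprem γ hγ)] at hle
    cases hb : boolEval a γ <;> simp_all [infLe, V3.ofBool]
  exact infLe_ofBool_true.1 (hconcl ▸ ha I.concl)

theorem ofBool_mem_sStd {b : Bool} : V3.ofBool b ∈ sStd ↔ b = true := by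
  cases b <;> simp [V3.ofBool, sStd]

theorem ofBool_mem_tStd {b : Bool} : V3.ofBool b ∈ tStd ↔ b = true := by
  cases b <;> simp [V3.ofBool, tStd]

theorem BooleanNormal.boolEval_of_mem_SS (hX : BooleanNormal X) {I : Infer} (hI : I ∈ SS X)
    (a : ℕ → Bool) (h : ∀ γ ∈ I.prem, boolEval a γ = true) : boolEval a I.concl = true :=
  ofBool_mem_sStd.1 (hI _ (hX.respects_boolEval a) fun γ hγ => ofBool_mem_sStd.2 (h γ hγ))

theorem BooleanNormal.boolEval_of_mem_TT (hX : BooleanNormal X) {I : Infer} (hI : I ∈ TT X)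
    (a : ℕ → Bool) (h : ∀ γ ∈ I.prem, boolEval a γ = true) : boolEval a I.concl = true :=
  ofBool_mem_tStd.1 (hI _ (hX.respects_boolEval a) fun γ hγ => ofBool_mem_tStd.2 (h γ hγ))

end Scheme

/-- The inclusion SS(X) ∪ TT(X') ⊆ ST(X'') is strict, witnessed by
{p ∨ (q ∧ ¬q)} ⇒ p ∧ (r ∨ ¬r). -/
theorem stmt7 : ∀ X X' X'' : Scheme, BNM X → BNM X' → BNM X'' →
    (SS X ∪ TT X' ⊂ ST X'') ∧
    ∀ p q r : ℕ, p ≠ q → p ≠ r → q ≠ r →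
      (⟨{Fml.disj (.var p) (.conj (.var q) (.neg (.var q)))},
         Fml.conj (.var p) (.disj (.var r) (.neg (.var r)))⟩ : Infer) ∈ ST X'' ∧
      (⟨{Fml.disj (.var p) (.conj (.var q) (.neg (.var q)))},
         Fml.conj (.var p) (.disj (.var r) (.neg (.var r)))⟩ : Infer) ∉ SS X ∧
      (⟨{Fml.disj (.var p) (.conj (.var q) (.neg (.var q)))},
         Fml.conj (.var p) (.disj (.var r) (.neg (.var r)))⟩ : Infer) ∉ TT X' := by
  intro X X' X'' hX hX' hX''
  have witness : ∀ p q r : ℕ, p ≠ q → p ≠ r → q ≠ r →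
      (⟨{Fml.disj (.var p) (.conj (.var q) (.neg (.var q)))},
         Fml.conj (.var p) (.disj (.var r) (.neg (.var r)))⟩ : Infer) ∈ ST X'' ∧
      (⟨{Fml.disj (.var p) (.conj (.var q) (.neg (.var q)))},
         Fml.conj (.var p) (.disj (.var r) (.neg (.var r)))⟩ : Infer) ∉ SS X ∧
      (⟨{Fml.disj (.var p) (.conj (.var q) (.neg (.var q)))},
         Fml.conj (.var p) (.disj (.var r) (.neg (.var r)))⟩ : Infer) ∉ TT X' := by
    intro p q r hpq hpr hqr
    refine ⟨hX''.mem_ST_of_boolEval fun a h => ?_, fun h => ?_, fun h => ?_⟩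
    · simpa [boolEval] using h
    · obtain ⟨hneg, _, _, _, hconj, _, _, hdisj, _⟩ := hX.1
      have hval := h _ (X.respects_eval fun n =>
        if n = p then .one else if n = q then .zero else .half)
      simp [Scheme.eval, sStd, hpq.symm, hpr.symm, hqr.symm, hneg, hconj, hdisj, hX.fneg_half,
        hX.fdisj_half_half, hX.fconj_one_half] at hval
    · obtain ⟨_, hneg, _, _, hconj, _, _, hdisj, _⟩ := hX'.1
      have hval := h _ (X'.respects_eval fun n =>
        if n = p then .zero else if n = q then .half else .one)
      simp [Scheme.eval, tStd, hpq.symm, hpr.symm, hqr.symm, hneg, hconj, hdisj, hX'.fneg_half,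
        hX'.fconj_half_half, hX'.fdisj_zero_half] at hval
  refine ⟨⟨?_, fun hsub => ?_⟩, witness⟩
  · rintro I (hI | hI)
    · exact hX''.mem_ST_of_boolEval (hX.1.boolEval_of_mem_SS hI)
    · exact hX''.mem_ST_of_boolEval (hX'.1.boolEval_of_mem_TT hI)
  · obtain ⟨hST, hSS, hTT⟩ := witness 0 1 2 (by decide) (by decide) (by decide)
    exact (hsub hST).elim hSS hTT

end ThreeValued
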